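/- Consider a controlled Markov process with finite nonempty state space S, finite nonempty action space A, row-stochastic dynamics P : S → A → S → ℝ, and discount γ ∈ (0,1). Then for all s, g ∈ S with s ≠ g and all a, a' ∈ A: ⨆_{π ∈ Π} occSA γ π (s,a) (g,a') / occSA γ π (g,a') (g,a') = ⨆_{π ∈ Π} LS γ π (s,a) g, where LS γ π (s,a) g = Σ_{h=0}^∞ γ^h · fS h (s,a) g is the Laplace transform of the first time the state component of the Q_π-chain equals g. (The key identity in the proof of the paper's Lemma 4.4: exp(−d_SD((s,a),(g,a'))) = max_π E[γ^{H^π_{s,a}(g)}].) -/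

import Mathlib

open scoped BigOperators

variable {S A : Type*} [Fintype S] [DecidableEq S] [Nonempty S]
  [Fintype A] [DecidableEq A] [Nonempty A]

/-- Row-stochastic controlled dynamics. -/
def IsDynamics (P : S → A → S → ℝ) : Prop :=
  (∀ s a s', 0 ≤ P s a s') ∧ ∀ s a, ∑ s', P s a s' = 1

/-- Stationary stochastic policy. -/
def IsPolicy (π : S → A → ℝ) : Prop :=
  (∀ s a, 0 ≤ π s a) ∧ ∀ s, ∑ a, π s a = 1

/-- The set of stationary stochastic policies, as a subtype. -/
abbrev Pol (S A : Type*) [Fintype A] : Type _ := {π : S → A → ℝ // IsPolicy π}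

/-- State-transition matrix induced by policy `π`. -/
noncomputable def Pmat (P : S → A → S → ℝ) (π : S → A → ℝ) : Matrix S S ℝ :=
  fun s s' => ∑ a, π s a * P s a s'

/-- Discounted state occupancy measure under policy `π`. -/
noncomputable def occC (γ : ℝ) (P : S → A → S → ℝ) (π : S → A → ℝ) (s g : S) : ℝ :=
  (1 - γ) * ∑' t : ℕ, γ ^ t * ((Pmat P π) ^ t) s g

/-- State-action transition matrix on `S × A` induced by policy `π`. -/
noncomputable def Qmat (P : S → A → S → ℝ) (π : S → A → ℝ) :
    Matrix (S × A) (S × A) ℝ :=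
  fun x y => P x.1 x.2 y.1 * π y.1 y.2

/-- Discounted state-action occupancy measure under policy `π`. -/
noncomputable def occSA (γ : ℝ) (P : S → A → S → ℝ) (π : S → A → ℝ)
    (x y : S × A) : ℝ :=
  (1 - γ) * ∑' t : ℕ, γ ^ t * ((Qmat P π) ^ t) x y

/-- First-passage probabilities of the state component of the `Qmat`-chain. -/
noncomputable def fS (P : S → A → S → ℝ) (π : S → A → ℝ) :
    ℕ → S × A → S → ℝ
  | 0, x, g => if x.1 = g then 1 else 0
  | h + 1, x, g => if x.1 = g then 0 else ∑ y : S × A, Qmat P π x y * fS P π h y g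

/-- Laplace transform of the first time the state component of the chain hits `g`. -/
noncomputable def LS (γ : ℝ) (P : S → A → S → ℝ) (π : S → A → ℝ)
    (x : S × A) (g : S) : ℝ :=
  ∑' h : ℕ, γ ^ h * fS P π h x g

theorem aux_maxp {X : Type*} [Fintype X] (γ : ℝ) (hγ0 : 0 < γ) (hγ1 : γ < 1)
    (Q : Matrix X X ℝ) (h0 : ∀ x y, 0 ≤ Q x y) (h1 : ∀ x, ∑ y, Q x y = 1) (U : X → ℝ)
    (hU : ∀ x, U x ≤ 0 ∨ U x ≤ γ * ∑ z, Q x z * U z) (x : X) : U x ≤ 0 := by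
  haveI : Nonempty X := ⟨x⟩
  obtain ⟨m, hm⟩ := Finite.exists_max U
  refine (hm x).trans ?_
  rcases hU m with h | h
  · exact h
  · have h2 : ∑ z, Q m z * U z ≤ U m := by
      calc ∑ z, Q m z * U z ≤ ∑ z, Q m z * U m :=
            Finset.sum_le_sum fun z _ => mul_le_mul_of_nonneg_left (hm z) (h0 m z)
        _ = U m := by rw [← Finset.sum_mul, h1, one_mul]
    nlinarith

theorem aux_pow {X : Type*} [Fintype X] [DecidableEq X]
    (Q : Matrix X X ℝ) (h0 : ∀ x y, 0 ≤ Q x y) (h1 : ∀ x, ∑ y, Q x y = 1) (t : ℕ) (y : X) :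
    ∀ x, 0 ≤ (Q ^ t) x y ∧ (Q ^ t) x y ≤ 1 := by
  induction t with
  | zero =>
    intro x
    rw [pow_zero, Matrix.one_apply]
    split_ifs <;> norm_num
  | succ n ih =>
    intro x
    rw [pow_succ', Matrix.mul_apply]
    refine ⟨Finset.sum_nonneg fun z _ => mul_nonneg (h0 x z) (ih z).1, ?_⟩
    rw [← h1 x]
    exact Finset.sum_le_sum fun z _ => mul_le_of_le_one_right (h0 x z) (ih z).2

theorem aux_summable (γ : ℝ) (hγ0 : 0 < γ) (hγ1 : γ < 1) (f : ℕ → ℝ)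
    (hf : ∀ t, 0 ≤ f t ∧ f t ≤ 1) : Summable fun t => γ ^ t * f t :=
  Summable.of_nonneg_of_le (fun t => mul_nonneg (pow_nonneg hγ0.le t) (hf t).1)
    (fun t => mul_le_of_le_one_right (pow_nonneg hγ0.le t) (hf t).2)
    (summable_geometric_of_lt_one hγ0.le hγ1)

theorem aux_step {X : Type*} [Fintype X] (γ : ℝ) (c : X → ℝ) (f : ℕ → X → ℝ)
    (f' : ℕ → ℝ) (hs' : Summable fun t => γ ^ t * f' t)
    (hs : ∀ z, Summable fun t => γ ^ t * f t z)
    (hf : ∀ t, f' (t + 1) = ∑ z, c z * f t z) :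
    ∑' t, γ ^ t * f' t = f' 0 + γ * ∑ z, c z * ∑' t, γ ^ t * f t z := by
  rw [hs'.tsum_eq_zero_add]
  simp only [pow_zero, one_mul]
  congr 1
  simp_rw [← tsum_mul_left]
  rw [← Summable.tsum_finsetSum (fun z _ => (hs z).mul_left (c z)), ← tsum_mul_left]
  refine tsum_congr fun t => ?_
  rw [hf, Finset.mul_sum, Finset.mul_sum]
  exact Finset.sum_congr rfl fun z _ => by ring

theorem aux_Q0 (P : S → A → S → ℝ) (hP : IsDynamics P) (π : S → A → ℝ) (hπ : IsPolicy π)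
    (x y : S × A) : 0 ≤ Qmat P π x y := mul_nonneg (hP.1 _ _ _) (hπ.1 _ _)

theorem aux_Q1 (P : S → A → S → ℝ) (hP : IsDynamics P) (π : S → A → ℝ) (hπ : IsPolicy π)
    (x : S × A) : ∑ y, Qmat P π x y = 1 := by
  simp only [Qmat, Fintype.sum_prod_type]
  simp_rw [← Finset.mul_sum, hπ.2, mul_one]
  exact hP.2 _ _

theorem aux_fS (P : S → A → S → ℝ) (hP : IsDynamics P) (π : S → A → ℝ) (hπ : IsPolicy π)
    (g : S) (h : ℕ) : ∀ x, 0 ≤ fS P π h x g ∧ fS P π h x g ≤ 1 := by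
  induction h with
  | zero => intro x; simp only [fS]; split_ifs <;> norm_num
  | succ n ih =>
    intro x
    simp only [fS]
    split_ifs
    · norm_num
    · refine ⟨Finset.sum_nonneg fun z _ => mul_nonneg (aux_Q0 P hP π hπ x z) (ih z).1, ?_⟩
      rw [← aux_Q1 P hP π hπ x]
      exact Finset.sum_le_sum fun z _ =>
        mul_le_of_le_one_right (aux_Q0 P hP π hπ x z) (ih z).2

theorem aux_LS_g (γ : ℝ) (P : S → A → S → ℝ) (π : S → A → ℝ) (g : S) (x : S × A)
    (hx : x.1 = g) : LS γ P π x g = 1 := by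
  unfold LS
  rw [tsum_eq_single 0]
  · simp [fS, hx]
  · intro h hh
    obtain ⟨n, rfl⟩ := Nat.exists_eq_succ_of_ne_zero hh
    simp [fS, hx]

theorem aux_LS_step (γ : ℝ) (hγ0 : 0 < γ) (hγ1 : γ < 1) (P : S → A → S → ℝ)
    (hP : IsDynamics P) (π : S → A → ℝ) (hπ : IsPolicy π) (g : S) (x : S × A)
    (hx : x.1 ≠ g) : LS γ P π x g = γ * ∑ z, Qmat P π x z * LS γ P π z g := by
  have hs : ∀ z, Summable fun t => γ ^ t * fS P π t z g := fun z =>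
    aux_summable γ hγ0 hγ1 _ fun t => aux_fS P hP π hπ g t z
  have := aux_step γ (Qmat P π x) (fun t z => fS P π t z g) (fun t => fS P π t x g)
    (hs x) hs (fun t => by simp [fS, hx])
  unfold LS
  rw [this]
  simp [fS, hx]

theorem aux_LS_le (γ : ℝ) (hγ0 : 0 < γ) (hγ1 : γ < 1) (P : S → A → S → ℝ)
    (hP : IsDynamics P) (π : S → A → ℝ) (hπ : IsPolicy π) (g : S) (x : S × A) :
    LS γ P π x g ≤ 1 := by
  have := aux_maxp γ hγ0 hγ1 (Qmat P π) (aux_Q0 P hP π hπ) (aux_Q1 P hP π hπ)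
    (fun z => LS γ P π z g - 1) (fun z => by
      by_cases hz : z.1 = g
      · left; simp [aux_LS_g γ P π g z hz]
      · right
        simp only [mul_sub, Finset.sum_sub_distrib, mul_one, aux_Q1 P hP π hπ z]
        rw [← aux_LS_step γ hγ0 hγ1 P hP π hπ g z hz]
        linarith) x
  simpa using this

noncomputable def auxV (γ : ℝ) (P : S → A → S → ℝ) (π : S → A → ℝ) (y x : S × A) : ℝ :=
  ∑' t : ℕ, γ ^ t * ((Qmat P π) ^ t) x y

theorem aux_V_step (γ : ℝ) (hγ0 : 0 < γ) (hγ1 : γ < 1) (P : S → A → S → ℝ)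
    (hP : IsDynamics P) (π : S → A → ℝ) (hπ : IsPolicy π) (y x : S × A) :
    auxV γ P π y x = (if x = y then 1 else 0) + γ * ∑ z, Qmat P π x z * auxV γ P π y z := by
  have hs : ∀ z, Summable fun t => γ ^ t * (Qmat P π ^ t) z y := fun z =>
    aux_summable γ hγ0 hγ1 _ fun t => 
      aux_pow _ (aux_Q0 P hP π hπ) (aux_Q1 P hP π hπ) t y z
  have := aux_step γ (Qmat P π x) (fun t z => (Qmat P π ^ t) z y)
    (fun t => (Qmat P π ^ t) x y)
    (hs x) hs (fun t => by simp only [pow_succ', Matrix.mul_apply])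
  unfold auxV
  rw [this]
  simp [Matrix.one_apply]

theorem aux_V_nonneg (γ : ℝ) (hγ0 : 0 < γ) (P : S → A → S → ℝ)
    (hP : IsDynamics P) (π : S → A → ℝ) (hπ : IsPolicy π) (y x : S × A) :
    0 ≤ auxV γ P π y x :=
  tsum_nonneg fun t => mul_nonneg (pow_nonneg hγ0.le t)
    (aux_pow _ (aux_Q0 P hP π hπ) (aux_Q1 P hP π hπ) t y x).1

theorem aux_V_pos (γ : ℝ) (hγ0 : 0 < γ) (hγ1 : γ < 1) (P : S → A → S → ℝ)
    (hP : IsDynamics P) (π : S → A → ℝ) (hπ : IsPolicy π) (y : S × A) :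
    0 < auxV γ P π y y := by
  rw [aux_V_step γ hγ0 hγ1 P hP π hπ, if_pos rfl]
  have : 0 ≤ ∑ z, Qmat P π y z * auxV γ P π y z := Finset.sum_nonneg fun z _ =>
    mul_nonneg (aux_Q0 P hP π hπ y z) (aux_V_nonneg γ hγ0 P hP π hπ y z)
  positivity

theorem aux_V_max (γ : ℝ) (hγ0 : 0 < γ) (hγ1 : γ < 1) (P : S → A → S → ℝ)
    (hP : IsDynamics P) (π : S → A → ℝ) (hπ : IsPolicy π) (y x : S × A) :
    auxV γ P π y x ≤ auxV γ P π y y := by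
  have hpos := aux_V_pos γ hγ0 hγ1 P hP π hπ y
  have := aux_maxp γ hγ0 hγ1 (Qmat P π) (aux_Q0 P hP π hπ) (aux_Q1 P hP π hπ)
    (fun z => auxV γ P π y z - auxV γ P π y y) (fun z => by
      by_cases hz : z = y
      · left; simp [hz]
      · right
        simp only [mul_sub, Finset.sum_sub_distrib, ← Finset.sum_mul, aux_Q1 P hP π hπ z]
        have := aux_V_step γ hγ0 hγ1 P hP π hπ y z
        rw [if_neg hz] at this
        nlinarith) x
  simpa using this

/-- the defect -/
noncomputable def auxW (γ : ℝ) (P : S → A → S → ℝ) (π : S → A → ℝ) (y x : S × A) : ℝ :=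
  auxV γ P π y x - auxV γ P π y y * LS γ P π x y.1

theorem aux_W_step (γ : ℝ) (hγ0 : 0 < γ) (hγ1 : γ < 1) (P : S → A → S → ℝ)
    (hP : IsDynamics P) (π : S → A → ℝ) (hπ : IsPolicy π) (y x : S × A) (hx : x.1 ≠ y.1) :
    auxW γ P π y x = γ * ∑ z, Qmat P π x z * auxW γ P π y z := by
  have e1 := aux_V_step γ hγ0 hγ1 P hP π hπ y x
  have e2 := aux_LS_step γ hγ0 hγ1 P hP π hπ y.1 x hx
  rw [if_neg (fun h => hx (by rw [h]))] at e1
  have e3 : ∑ z, Qmat P π x z * auxW γ P π y z = ∑ z, Qmat P π x z * auxV γ P π y z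
      - auxV γ P π y y * ∑ z, Qmat P π x z * LS γ P π z y.1 := by
    rw [Finset.mul_sum, ← Finset.sum_sub_distrib]
    exact Finset.sum_congr rfl fun z _ => by unfold auxW; ring
  rw [e3]
  unfold auxW
  linear_combination e1 - auxV γ P π y y * e2

theorem aux_W_le (γ : ℝ) (hγ0 : 0 < γ) (hγ1 : γ < 1) (P : S → A → S → ℝ)
    (hP : IsDynamics P) (π : S → A → ℝ) (hπ : IsPolicy π) (y x : S × A) :
    auxW γ P π y x ≤ 0 := by
  refine aux_maxp γ hγ0 hγ1 (Qmat P π) (aux_Q0 P hP π hπ) (aux_Q1 P hP π hπ) _ (fun z => ?_) x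
  by_cases hz : z.1 = y.1
  · left
    unfold auxW
    rw [aux_LS_g γ P π y.1 z hz]
    linarith [aux_V_max γ hγ0 hγ1 P hP π hπ y z]
  · right
    exact (aux_W_step γ hγ0 hγ1 P hP π hπ y z hz).le

theorem aux_W_ge (γ : ℝ) (hγ0 : 0 < γ) (hγ1 : γ < 1) (P : S → A → S → ℝ)
    (hP : IsDynamics P) (π : S → A → ℝ) (hπ : IsPolicy π) (y x : S × A) (hx : x.1 ≠ y.1)
    (hy : ∀ b, b ≠ y.2 → π y.1 b = 0) : 0 ≤ auxW γ P π y x := by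
  have := aux_maxp γ hγ0 hγ1 (Qmat P π) (aux_Q0 P hP π hπ) (aux_Q1 P hP π hπ)
    (fun z => if z.1 = y.1 then 0 else - auxW γ P π y z) (fun z => by
      by_cases hz : z.1 = y.1
      · left; simp [hz]
      · right
        rw [if_neg hz, aux_W_step γ hγ0 hγ1 P hP π hπ y z hz, ← mul_neg,
          ← Finset.sum_neg_distrib]
        refine le_of_eq ?_
        congr 1
        refine Finset.sum_congr rfl fun w _ => ?_
        split_ifs with hw
        · by_cases hw2 : w.2 = y.2
          · have : w = y := Prod.ext hw hw2
            subst this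
            simp [auxW, aux_LS_g γ P π w.1 w rfl]
          · simp [Qmat, hw, hy _ hw2]
        · ring) x
  simp only [if_neg hx] at this
  linarith

theorem aux_fS_congr (P : S → A → S → ℝ) (π π' : S → A → ℝ) (hπ : IsPolicy π)
    (hπ' : IsPolicy π') (g : S) (hh : ∀ s, s ≠ g → π s = π' s) (h : ℕ) :
    ∀ x, fS P π h x g = fS P π' h x g := by
  induction h with
  | zero => intro x; simp [fS]
  | succ n ih =>
    intro x
    simp only [fS]
    split_ifs with hx
    · rfl
    · simp only [Qmat, Fintype.sum_prod_type]
      refine Finset.sum_congr rfl fun s' _ => ?_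
      by_cases hs : s' = g
      · have hc : ∀ b, fS P π' n (s', b) g = if n = 0 then 1 else 0 := by
          intro b
          cases n <;> simp [fS, hs]
        simp_rw [ih, hc, ← Finset.sum_mul, ← Finset.mul_sum, hπ.2, hπ'.2]
      · simp_rw [ih, hh s' hs]

theorem aux_ratio (γ : ℝ) (hγ1 : γ < 1) (P : S → A → S → ℝ) (π : S → A → ℝ) (y x : S × A) :
    occSA γ P π x y / occSA γ P π y y = auxV γ P π y x / auxV γ P π y y := by
  unfold occSA
  exact mul_div_mul_left _ _ (by linarith)

theorem aux_ratio_le (γ : ℝ) (hγ0 : 0 < γ) (hγ1 : γ < 1) (P : S → A → S → ℝ)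
    (hP : IsDynamics P) (π : S → A → ℝ) (hπ : IsPolicy π) (y x : S × A) :
    occSA γ P π x y / occSA γ P π y y ≤ LS γ P π x y.1 := by
  rw [aux_ratio γ hγ1, div_le_iff₀ (aux_V_pos γ hγ0 hγ1 P hP π hπ y)]
  have := aux_W_le γ hγ0 hγ1 P hP π hπ y x
  unfold auxW at this
  linarith

/-- The successor value on state-action pairs equals the optimal Laplace transform
of the hitting time of the state `g` (key identity in Lemma 4.4). -/
theorem sup_occSA_ratio_eq_sup_LS (γ : ℝ) (hγ0 : 0 < γ) (hγ1 : γ < 1)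
    (P : S → A → S → ℝ) (hP : IsDynamics P)
    (s g : S) (hsg : s ≠ g) (a a' : A) :
    (⨆ π : Pol S A, occSA γ P π.1 (s, a) (g, a') / occSA γ P π.1 (g, a') (g, a')) =
      ⨆ π : Pol S A, LS γ P π.1 (s, a) g := by
  have hd : IsPolicy (fun (_ : S) (b : A) => if b = a' then (1 : ℝ) else 0) := by
    refine ⟨fun _ b => ?_, fun _ => by simp⟩
    dsimp only
    split_ifs <;> norm_num
  haveI : Nonempty (Pol S A) := ⟨⟨_, hd⟩⟩
  have hle : ∀ π : Pol S A, occSA γ P π.1 (s, a) (g, a') / occSA γ P π.1 (g, a') (g, a')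
      ≤ LS γ P π.1 (s, a) g := fun π =>
    aux_ratio_le γ hγ0 hγ1 P hP π.1 π.2 (g, a') (s, a)
  have hL : ∀ π : Pol S A, LS γ P π.1 (s, a) g ≤ 1 := fun π =>
    aux_LS_le γ hγ0 hγ1 P hP π.1 π.2 g (s, a)
  apply le_antisymm
  · exact ciSup_mono ⟨1, by rintro _ ⟨π, rfl⟩; exact hL π⟩ hle
  · refine ciSup_le fun π => ?_
    let π' : S → A → ℝ := fun t b => if t = g then (if b = a' then 1 else 0) else π.1 t b
    have hπ' : IsPolicy π' := by
      refine ⟨fun t b => ?_, fun t => ?_⟩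
      · simp only [π']
        split_ifs
        · norm_num
        · norm_num
        · exact π.2.1 t b
      · by_cases ht : t = g
        · simp [π', ht]
        · simp [π', ht, π.2.2 t]
    refine le_ciSup_of_le ⟨1, by rintro _ ⟨π, rfl⟩; exact (hle π).trans (hL π)⟩ ⟨π', hπ'⟩ ?_
    have e : LS γ P π.1 (s, a) g = LS γ P π' (s, a) g := by
      unfold LS
      refine tsum_congr fun t => ?_
      rw [aux_fS_congr P π.1 π' π.2 hπ' g (fun t ht => by funext b; simp [π', ht]) t]
    rw [e]
    dsimp only
    rw [aux_ratio γ hγ1, le_div_iff₀ (aux_V_pos γ hγ0 hγ1 P hP π' hπ' _)]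
    have := aux_W_ge γ hγ0 hγ1 P hP π' hπ' (g, a') (s, a) hsg
      (fun b hb => by simp [π']; exact hb)
    unfold auxW at this
    dsimp only at this
    linarith
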